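/- arXiv:2201.03635 — 9 statements merged into one kernel-verified Lean document; each statement's English description precedes it below -/
import Mathlib

section
/- If u : ℝ × ℝ → ℝ is a smooth solution of equation (∗), then for any real constant λ the scaled function v(t,x) := λ·u(λt, x) is also a smooth solution of (∗). -/
open Real MeasureTheory Set Filter

/-- Partial derivative of `u` with respect to the first (time) variable. -/
noncomputable def ut (u : ℝ × ℝ → ℝ) (t x : ℝ) : ℝ := deriv (fun s => u (s, x)) t
/-- Partial derivative of `u` with respect to the second (spatial) variable. -/
noncomputable def ux (u : ℝ × ℝ → ℝ) (t x : ℝ) : ℝ := deriv (fun y => u (t, y)) x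
noncomputable def uxx (u : ℝ × ℝ → ℝ) (t x : ℝ) : ℝ := deriv (fun y => ux u t y) x
noncomputable def uxxx (u : ℝ × ℝ → ℝ) (t x : ℝ) : ℝ := deriv (fun y => uxx u t y) x
noncomputable def utx (u : ℝ × ℝ → ℝ) (t x : ℝ) : ℝ := deriv (fun y => ut u t y) x
noncomputable def utxx (u : ℝ × ℝ → ℝ) (t x : ℝ) : ℝ := deriv (fun y => utx u t y) x

/-- `u` satisfies the Novikov-type equation (∗) at the point `(t, x)`. -/
def SolvesAt (u : ℝ × ℝ → ℝ) (t x : ℝ) : Prop :=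
  ut u t x - utxx u t x =
    4 * u (t, x) * ux u t x + 2 * (ux u t x) ^ 2 + 2 * u (t, x) * uxx u t x
      - 6 * ux u t x * uxx u t x - 2 * u (t, x) * uxxx u t x

/-- `u` is a solution of the Novikov-type equation (∗) on all of `ℝ × ℝ`. -/
def IsSolution (u : ℝ × ℝ → ℝ) : Prop := ∀ t x : ℝ, SolvesAt u t x

/-- The image of `u` under the scaling `(t, x) ↦ (lam * t, x)`, `u ↦ lam * u`. -/
def timeScale (lam : ℝ) (u : ℝ × ℝ → ℝ) (p : ℝ × ℝ) : ℝ := lam * u (lam * p.1, p.2)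

section timeScale

variable (lam : ℝ) (u : ℝ × ℝ → ℝ) (t x : ℝ)

theorem ut_timeScale : ut (timeScale lam u) t x = lam ^ 2 * ut u (lam * t) x := by
  have h := deriv_comp_mul_left lam (fun s => u (s, x)) t
  simp only [ut, timeScale, deriv_const_mul_field] at h ⊢
  rw [h, smul_eq_mul]
  ring

theorem utx_timeScale : utx (timeScale lam u) t x = lam ^ 2 * utx u (lam * t) x := by
  simp only [utx, ut_timeScale, deriv_const_mul_field]

theorem utxx_timeScale : utxx (timeScale lam u) t x = lam ^ 2 * utxx u (lam * t) x := by
  simp only [utxx, utx_timeScale, deriv_const_mul_field]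

theorem ux_timeScale : ux (timeScale lam u) t x = lam * ux u (lam * t) x := by
  simp only [ux, timeScale, deriv_const_mul_field]

theorem uxx_timeScale : uxx (timeScale lam u) t x = lam * uxx u (lam * t) x := by
  simp only [uxx, ux_timeScale, deriv_const_mul_field]

theorem uxxx_timeScale : uxxx (timeScale lam u) t x = lam * uxxx u (lam * t) x := by
  simp only [uxxx, uxx_timeScale, deriv_const_mul_field]

variable {lam u t x}

theorem SolvesAt.timeScale (h : SolvesAt u (lam * t) x) :
    SolvesAt (timeScale lam u) t x := by
  unfold SolvesAt at h ⊢
  rw [ut_timeScale, utxx_timeScale, ux_timeScale, uxx_timeScale, uxxx_timeScale]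
  simp only [_root_.timeScale]
  linear_combination lam ^ 2 * h

end timeScale

/-- The scaling symmetry generated by `X₃ = t ∂_t − u ∂_u`: if `u` is a smooth solution
of (∗), then `v (t, x) = λ · u (λ t, x)` is also a smooth solution. -/
theorem scaling_invariance (u : ℝ × ℝ → ℝ) (hu : ContDiff ℝ (⊤ : ℕ∞) u)
    (hsol : IsSolution u) (lam : ℝ) :
    ContDiff ℝ (⊤ : ℕ∞) (fun p : ℝ × ℝ => lam * u (lam * p.1, p.2)) ∧
      IsSolution (fun p : ℝ × ℝ => lam * u (lam * p.1, p.2)) := by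
  refine ⟨by fun_prop, fun t x => ?_⟩
  exact SolvesAt.timeScale (hsol (lam * t) x)
end

section
/- For any real constant a, the stationary function u(t,x) := a·e^{−x/2} is a solution of equation (∗) on ℝ × ℝ. -/
open Real MeasureTheory Set Filter

theorem hasDerivAt_const_mul_exp_neg_half (c x : ℝ) :
    HasDerivAt (fun y : ℝ => c * Real.exp (-y / 2)) (-c / 2 * Real.exp (-x / 2)) x := by
  have h := (((hasDerivAt_id' x).fun_neg.div_const 2).exp).const_mul c
  exact h.congr_deriv (by ring)

theorem deriv_const_mul_exp_neg_half (c : ℝ) :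
    deriv (fun y : ℝ => c * Real.exp (-y / 2)) = fun x => -c / 2 * Real.exp (-x / 2) :=
  funext fun x => (hasDerivAt_const_mul_exp_neg_half c x).deriv

/-- The stationary invariant solution (2.0.8): `u (t, x) = a · e^{−x/2}` solves (∗). -/
theorem stationary_exp_solution (a : ℝ) :
    IsSolution (fun p : ℝ × ℝ => a * Real.exp (-p.2 / 2)) := by
  intro t x
  simp only [SolvesAt, utxx, utx, ut, uxxx, uxx, ux, deriv_const_mul_exp_neg_half, deriv_const]
  ring
end

section
/- Let a, b be real constants and let I ⊆ ℝ be an open interval such that a·e^{−x} + b > 0 for all x ∈ I. Then the stationary function u(t,x) := √(a·e^{−x} + b) is a solution of equation (∗) on ℝ × I. -/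
open Real MeasureTheory Set Filter

/-- The derivative of `√(a e^{−x} + b)` where the radicand is positive. -/
theorem hasDerivAt_sqrt_exp_neg {a b x : ℝ} (h : 0 < a * Real.exp (-x) + b) :
    HasDerivAt (fun y => Real.sqrt (a * Real.exp (-y) + b))
      (-(a * Real.exp (-x)) / (2 * Real.sqrt (a * Real.exp (-x) + b))) x := by
  have hv : HasDerivAt (fun y => a * Real.exp (-y) + b) (-(a * Real.exp (-x))) x := by
    refine ((((hasDerivAt_neg x).exp).const_mul a).add_const b).congr_deriv ?_
    ring
  exact hv.sqrt h.ne'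

/-- The second derivative of `√(a e^{−x} + b)` where the radicand is positive. -/
theorem hasDerivAt_deriv_sqrt_exp_neg {a b x : ℝ} (h : 0 < a * Real.exp (-x) + b) :
    HasDerivAt (fun y => -(a * Real.exp (-y)) / (2 * Real.sqrt (a * Real.exp (-y) + b)))
      (a * Real.exp (-x) / (2 * Real.sqrt (a * Real.exp (-x) + b))
        - (a * Real.exp (-x)) ^ 2 / (4 * Real.sqrt (a * Real.exp (-x) + b) ^ 3)) x := by
  have hs := (Real.sqrt_pos.2 h).ne'
  have hE := ((hasDerivAt_neg x).exp).const_mul a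
  refine (hE.fun_neg.fun_div ((hasDerivAt_sqrt_exp_neg h).const_mul 2)
    (mul_ne_zero two_ne_zero hs)).congr_deriv ?_
  field_simp
  ring

/-- The third derivative of `√(a e^{−x} + b)` where the radicand is positive. -/
theorem hasDerivAt_deriv_deriv_sqrt_exp_neg {a b x : ℝ} (h : 0 < a * Real.exp (-x) + b) :
    HasDerivAt (fun y => a * Real.exp (-y) / (2 * Real.sqrt (a * Real.exp (-y) + b))
        - (a * Real.exp (-y)) ^ 2 / (4 * Real.sqrt (a * Real.exp (-y) + b) ^ 3))
      (-(a * Real.exp (-x)) / (2 * Real.sqrt (a * Real.exp (-x) + b))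
        + 3 * (a * Real.exp (-x)) ^ 2 / (4 * Real.sqrt (a * Real.exp (-x) + b) ^ 3)
        - 3 * (a * Real.exp (-x)) ^ 3 / (8 * Real.sqrt (a * Real.exp (-x) + b) ^ 5)) x := by
  have hs := (Real.sqrt_pos.2 h).ne'
  have hE := ((hasDerivAt_neg x).exp).const_mul a
  have hS := hasDerivAt_sqrt_exp_neg h
  refine ((hE.fun_div (hS.const_mul 2) (mul_ne_zero two_ne_zero hs)).fun_sub
    ((hE.fun_pow 2).fun_div ((hS.fun_pow 3).const_mul 4)
      (mul_ne_zero four_ne_zero (pow_ne_zero 3 hs)))).congr_deriv ?_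
  field_simp
  ring

/-- The non-generic stationary solution `u (t, x) = √(a e^{−x} + b)` solves (∗) on `ℝ × I`,
for any open interval `I` on which `a e^{−x} + b > 0`. -/
theorem sqrt_exp_neg_solution (a b : ℝ) (I : Set ℝ) (hI : IsOpen I)
    (hI' : I.OrdConnected) (hpos : ∀ x ∈ I, 0 < a * Real.exp (-x) + b) :
    ∀ t : ℝ, ∀ x ∈ I,
      SolvesAt (fun p : ℝ × ℝ => Real.sqrt (a * Real.exp (-p.2) + b)) t x := by
  intro t x hx
  set u : ℝ × ℝ → ℝ := fun p => Real.sqrt (a * Real.exp (-p.2) + b) with hu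
  have hux : ∀ y ∈ I, ux u t y =
      -(a * Real.exp (-y)) / (2 * Real.sqrt (a * Real.exp (-y) + b)) :=
    fun y hy => (hasDerivAt_sqrt_exp_neg (hpos y hy)).deriv
  have huxx : ∀ y ∈ I, uxx u t y =
      a * Real.exp (-y) / (2 * Real.sqrt (a * Real.exp (-y) + b))
        - (a * Real.exp (-y)) ^ 2 / (4 * Real.sqrt (a * Real.exp (-y) + b) ^ 3) :=
    fun y hy => ((hasDerivAt_deriv_sqrt_exp_neg (hpos y hy)).congr_of_eventuallyEq
      (eventually_of_mem (hI.mem_nhds hy) hux)).deriv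
  have huxxx := ((hasDerivAt_deriv_deriv_sqrt_exp_neg (hpos x hx)).congr_of_eventuallyEq
    (eventually_of_mem (hI.mem_nhds hx) huxx)).deriv
  have hut : ∀ y, ut u t y = 0 := fun y => by simp [ut, hu]
  have hutxx : utxx u t x = 0 := by simp [utxx, utx, hut]
  have hs := (Real.sqrt_pos.2 (hpos x hx)).ne'
  rw [SolvesAt, hut, hutxx, hux x hx, huxx x hx, uxxx, huxxx]
  simp only [hu]
  field_simp
  ring
end

section
/- Let a, b be real constants and let I ⊆ ℝ be an open interval such that a·e^{2x} + b > 0 for all x ∈ I. Then the stationary function u(t,x) := √(a·e^{2x} + b) is a solution of equation (∗) on ℝ × I. -/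
open Real MeasureTheory Set Filter

theorem hasDerivAt_mul_exp_two_mul (a x : ℝ) :
    HasDerivAt (fun y => a * Real.exp (2 * y)) (2 * (a * Real.exp (2 * x))) x := by
  have h : HasDerivAt (fun y : ℝ => 2 * y) 2 x := by
    simpa using (hasDerivAt_id x).const_mul (2 : ℝ)
  exact (h.exp.const_mul a).congr_deriv (by ring)

theorem hasDerivAt_sqrt_mul_exp_two_mul_add {a b x : ℝ}
    (h : 0 < a * Real.exp (2 * x) + b) :
    HasDerivAt (fun y => √(a * Real.exp (2 * y) + b))
      (a * Real.exp (2 * x) / √(a * Real.exp (2 * x) + b)) x := by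
  have hs := (Real.sqrt_pos.2 h).ne'
  refine (((hasDerivAt_mul_exp_two_mul a x).add_const b).sqrt h.ne').congr_deriv ?_
  field_simp

theorem hasDerivAt_deriv_sqrt_mul_exp_two_mul_add {a b x : ℝ}
    (h : 0 < a * Real.exp (2 * x) + b) :
    HasDerivAt (fun y => a * Real.exp (2 * y) / √(a * Real.exp (2 * y) + b))
      (2 * (a * Real.exp (2 * x)) / √(a * Real.exp (2 * x) + b)
        - (a * Real.exp (2 * x)) ^ 2 / √(a * Real.exp (2 * x) + b) ^ 3) x := by
  have hs := (Real.sqrt_pos.2 h).ne'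
  refine ((hasDerivAt_mul_exp_two_mul a x).div
    (hasDerivAt_sqrt_mul_exp_two_mul_add h) hs).congr_deriv ?_
  field_simp

theorem hasDerivAt_deriv_deriv_sqrt_mul_exp_two_mul_add {a b x : ℝ}
    (h : 0 < a * Real.exp (2 * x) + b) :
    HasDerivAt (fun y => 2 * (a * Real.exp (2 * y)) / √(a * Real.exp (2 * y) + b)
        - (a * Real.exp (2 * y)) ^ 2 / √(a * Real.exp (2 * y) + b) ^ 3)
      (4 * (a * Real.exp (2 * x)) / √(a * Real.exp (2 * x) + b)
        - 6 * (a * Real.exp (2 * x)) ^ 2 / √(a * Real.exp (2 * x) + b) ^ 3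
        + 3 * (a * Real.exp (2 * x)) ^ 3 / √(a * Real.exp (2 * x) + b) ^ 5) x := by
  have hs := (Real.sqrt_pos.2 h).ne'
  have hA := hasDerivAt_mul_exp_two_mul a x
  have hS := hasDerivAt_sqrt_mul_exp_two_mul_add h
  refine (((hA.const_mul 2).div hS hs).sub
    ((hA.pow 2).div (hS.pow 3) (pow_ne_zero 3 hs))).congr_deriv ?_
  simp only [Pi.pow_apply]
  field_simp
  ring

/-- The non-generic stationary solution `u (t, x) = √(a e^{2x} + b)` solves (∗) on `ℝ × I`,
for any open interval `I` on which `a e^{2x} + b > 0`. -/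
theorem sqrt_exp_two_solution (a b : ℝ) (I : Set ℝ) (hI : IsOpen I)
    (hI' : I.OrdConnected) (hpos : ∀ x ∈ I, 0 < a * Real.exp (2 * x) + b) :
    ∀ t : ℝ, ∀ x ∈ I,
      SolvesAt (fun p : ℝ × ℝ => Real.sqrt (a * Real.exp (2 * p.2) + b)) t x := by
  intro t x hx
  set u : ℝ × ℝ → ℝ := fun p => Real.sqrt (a * Real.exp (2 * p.2) + b) with hu
  have hux : ∀ y ∈ I, ux u t y = a * Real.exp (2 * y) / √(a * Real.exp (2 * y) + b) :=
    fun y hy => (hasDerivAt_sqrt_mul_exp_two_mul_add (hpos y hy)).deriv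
  have huxx : ∀ y ∈ I, uxx u t y = 2 * (a * Real.exp (2 * y)) / √(a * Real.exp (2 * y) + b)
      - (a * Real.exp (2 * y)) ^ 2 / √(a * Real.exp (2 * y) + b) ^ 3 := fun y hy =>
    ((hasDerivAt_deriv_sqrt_mul_exp_two_mul_add (hpos y hy)).congr_of_eventuallyEq
      (eventually_of_mem (hI.mem_nhds hy) hux)).deriv
  have huxxx : uxxx u t x = 4 * (a * Real.exp (2 * x)) / √(a * Real.exp (2 * x) + b)
        - 6 * (a * Real.exp (2 * x)) ^ 2 / √(a * Real.exp (2 * x) + b) ^ 3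
        + 3 * (a * Real.exp (2 * x)) ^ 3 / √(a * Real.exp (2 * x) + b) ^ 5 :=
    ((hasDerivAt_deriv_deriv_sqrt_mul_exp_two_mul_add (hpos x hx)).congr_of_eventuallyEq
      (eventually_of_mem (hI.mem_nhds hx) huxx)).deriv
  have hut : ∀ y, ut u t y = 0 := fun y => by simp [ut, hu]
  have hutxx : utxx u t x = 0 := by simp [utxx, utx, hut]
  have hs := (Real.sqrt_pos.2 (hpos x hx)).ne'
  rw [SolvesAt, hut, hutxx, hux x hx, huxx x hx, huxxx]
  simp only [hu]
  field_simp
  ring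
end

section
/- Let u : ℝ × ℝ → ℝ be a smooth solution of equation (∗). Then the conservation law ∂_t(u − u_{xx}) + ∂_x(2u_x² − 2u² − 2u u_x + 2u u_{xx}) = 0 holds identically on ℝ × ℝ. -/
open Real MeasureTheory Set Filter

theorem hasDerivAt_fst {u : ℝ × ℝ → ℝ} (hu : Differentiable ℝ u) (t x : ℝ) :
    HasDerivAt (fun s => u (s, x)) (fderiv ℝ u (t, x) (1, 0)) t :=
  (hu (t, x)).hasFDerivAt.comp_hasDerivAt t ((hasDerivAt_id t).prodMk (hasDerivAt_const t x))

theorem hasDerivAt_snd {u : ℝ × ℝ → ℝ} (hu : Differentiable ℝ u) (t x : ℝ) :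
    HasDerivAt (fun y => u (t, y)) (fderiv ℝ u (t, x) (0, 1)) x :=
  (hu (t, x)).hasFDerivAt.comp_hasDerivAt x ((hasDerivAt_const x t).prodMk (hasDerivAt_id x))

theorem ut_eq_fderiv {u : ℝ × ℝ → ℝ} (hu : Differentiable ℝ u) (t x : ℝ) :
    ut u t x = fderiv ℝ u (t, x) (1, 0) :=
  (hasDerivAt_fst hu t x).deriv

theorem ux_eq_fderiv {u : ℝ × ℝ → ℝ} (hu : Differentiable ℝ u) (t x : ℝ) :
    ux u t x = fderiv ℝ u (t, x) (0, 1) :=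
  (hasDerivAt_snd hu t x).deriv

theorem contDiff_ux {u : ℝ × ℝ → ℝ} (hu : ContDiff ℝ (⊤ : ℕ∞) u) :
    ContDiff ℝ (⊤ : ℕ∞) (fun p : ℝ × ℝ => ux u p.1 p.2) := by
  simp only [ux_eq_fderiv (hu.differentiable (by simp))]
  exact (hu.fderiv_right (by simp)).clm_apply contDiff_const

/-- Mixed partial derivatives of a smooth function commute. -/
theorem deriv_ux_eq_utx {u : ℝ × ℝ → ℝ} (hu : ContDiff ℝ (⊤ : ℕ∞) u) (t x : ℝ) :
    deriv (fun s => ux u s x) t = utx u t x := by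
  have hd : Differentiable ℝ u := hu.differentiable (by simp)
  have hd' : Differentiable ℝ (fderiv ℝ u) :=
    (hu.fderiv_right (m := (⊤ : ℕ∞)) (by simp)).differentiable (by simp)
  have hsymm : IsSymmSndFDerivAt ℝ u (t, x) :=
    (contDiff_infty.1 hu 2).contDiffAt.isSymmSndFDerivAt (by simp)
  have hs : HasDerivAt (fun s => fderiv ℝ u (s, x)) (fderiv ℝ (fderiv ℝ u) (t, x) (1, 0)) t :=
    (hd' (t, x)).hasFDerivAt.comp_hasDerivAt t ((hasDerivAt_id t).prodMk (hasDerivAt_const t x))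
  have hy : HasDerivAt (fun y => fderiv ℝ u (t, y)) (fderiv ℝ (fderiv ℝ u) (t, x) (0, 1)) x :=
    (hd' (t, x)).hasFDerivAt.comp_hasDerivAt x ((hasDerivAt_const x t).prodMk (hasDerivAt_id x))
  have hs' := hs.clm_apply (hasDerivAt_const t ((0, 1) : ℝ × ℝ))
  have hy' := hy.clm_apply (hasDerivAt_const x ((1, 0) : ℝ × ℝ))
  simp only [utx, ux_eq_fderiv hd, ut_eq_fderiv hd]
  rw [hs'.deriv, hy'.deriv]
  simpa using hsymm.eq (1, 0) (0, 1)

theorem deriv_uxx_eq_utxx {u : ℝ × ℝ → ℝ} (hu : ContDiff ℝ (⊤ : ℕ∞) u) (t x : ℝ) :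
    deriv (fun s => uxx u s x) t = utxx u t x := by
  have h := deriv_ux_eq_utx (contDiff_ux hu) t x
  have hut : ∀ y, ut (fun p : ℝ × ℝ => ux u p.1 p.2) t y = utx u t y :=
    fun y => deriv_ux_eq_utx hu t y
  simp only [utx, hut] at h
  exact h

/-- The conserved current (3.0.1): on smooth solutions of (∗),
`∂_t (u − u_xx) + ∂_x (2u_x² − 2u² − 2u u_x + 2u u_xx) = 0`. -/
theorem conservation_law_one (u : ℝ × ℝ → ℝ) (hu : ContDiff ℝ (⊤ : ℕ∞) u)
    (hsol : IsSolution u) :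
    ∀ t x : ℝ,
      deriv (fun s => u (s, x) - uxx u s x) t +
        deriv (fun y => 2 * (ux u t y) ^ 2 - 2 * (u (t, y)) ^ 2
          - 2 * u (t, y) * ux u t y + 2 * u (t, y) * uxx u t y) x = 0 := by
  intro t x
  have hux := contDiff_ux hu
  have huxx : ContDiff ℝ (⊤ : ℕ∞) (fun p : ℝ × ℝ => uxx u p.1 p.2) := contDiff_ux hux
  have hd : Differentiable ℝ u := hu.differentiable (by simp)
  have hdxx := huxx.differentiable (by simp)
  have h0t : HasDerivAt (fun s => u (s, x)) (ut u t x) t :=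
    (hasDerivAt_fst hd t x).differentiableAt.hasDerivAt
  have h2t : HasDerivAt (fun s => uxx u s x) (utxx u t x) t :=
    deriv_uxx_eq_utxx hu t x ▸ (hasDerivAt_fst hdxx t x).differentiableAt.hasDerivAt
  have h0 : HasDerivAt (fun y => u (t, y)) (ux u t x) x :=
    (hasDerivAt_snd hd t x).differentiableAt.hasDerivAt
  have h1 : HasDerivAt (fun y => ux u t y) (uxx u t x) x :=
    (hasDerivAt_snd (hux.differentiable (by simp)) t x).differentiableAt.hasDerivAt
  have h2 : HasDerivAt (fun y => uxx u t y) (uxxx u t x) x :=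
    (hasDerivAt_snd hdxx t x).differentiableAt.hasDerivAt
  have hflux : HasDerivAt (fun y => 2 * (ux u t y) ^ 2 - 2 * (u (t, y)) ^ 2
      - 2 * u (t, y) * ux u t y + 2 * u (t, y) * uxx u t y) _ x :=
    ((((h1.pow 2).const_mul 2).sub ((h0.pow 2).const_mul 2)).sub
      ((h0.const_mul 2).mul h1)).add ((h0.const_mul 2).mul h2)
  rw [(h0t.fun_sub h2t).deriv, hflux.deriv]
  have hpde := hsol t x
  unfold SolvesAt at hpde
  rw [hpde]
  push_cast
  ring
end

section
/- Let u : ℝ × ℝ → ℝ be a smooth solution of equation (∗) and let t ∈ ℝ be fixed. Assume that the function x ↦ u_t(t,x) is Lebesgue integrable on ℝ, and that u(t,x), u_x(t,x), u_{xx}(t,x) and u_{tx}(t,x) all tend to 0 as x → +∞ and as x → −∞. Then ∫_ℝ u_t(t,x) dx = 0; that is, the conserved quantity H₁(t) = ∫_ℝ u(t,x) dx has zero time derivative. -/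
open Real MeasureTheory Set Filter

lemma ContDiff.differentiable_and_deriv {f : ℝ → ℝ} (hf : ContDiff ℝ (⊤ : ℕ∞) f) :
    Differentiable ℝ f ∧ ContDiff ℝ (⊤ : ℕ∞) (deriv f) :=
  contDiff_infty_iff_deriv.1 hf

lemma ContDiff.ut_slice {u : ℝ × ℝ → ℝ} (hu : ContDiff ℝ (⊤ : ℕ∞) u) (t : ℝ) :
    ContDiff ℝ (⊤ : ℕ∞) (fun x => ut u t x) := by
  have h : (fun x => ut u t x) = fun x => fderiv ℝ u (t, x) (1, 0) := by
    funext x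
    have hline : HasDerivAt (fun s : ℝ => (s, x)) ((1 : ℝ), (0 : ℝ)) t :=
      (hasDerivAt_id t).prodMk (hasDerivAt_const t x)
    exact ((hu.differentiable (by simp) (t, x)).hasFDerivAt.comp_hasDerivAt t hline).deriv
  rw [h]
  have hfd : ContDiff ℝ (⊤ : ℕ∞) (fderiv ℝ u) := hu.fderiv_right (by simp)
  exact (hfd.comp (contDiff_const.prodMk contDiff_id)).clm_apply contDiff_const

/-- Theorem 3.2, quantity `H₁`: for a smooth solution of (∗) with `u_t (t, ·)` integrable and
`u, u_x, u_xx, u_tx` decaying at spatial infinity, `∫ u_t (t, x) dx = 0`, i.e. the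
conserved quantity `H₁ (t) = ∫ u (t, x) dx` has zero time derivative. -/
theorem conserved_quantity_H1 (u : ℝ × ℝ → ℝ) (hu : ContDiff ℝ (⊤ : ℕ∞) u)
    (hsol : IsSolution u) (t : ℝ)
    (hint : Integrable (fun x => ut u t x))
    (hu_top : Tendsto (fun x => u (t, x)) atTop (nhds 0))
    (hu_bot : Tendsto (fun x => u (t, x)) atBot (nhds 0))
    (hux_top : Tendsto (fun x => ux u t x) atTop (nhds 0))
    (hux_bot : Tendsto (fun x => ux u t x) atBot (nhds 0))
    (huxx_top : Tendsto (fun x => uxx u t x) atTop (nhds 0))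
    (huxx_bot : Tendsto (fun x => uxx u t x) atBot (nhds 0))
    (hutx_top : Tendsto (fun x => utx u t x) atTop (nhds 0))
    (hutx_bot : Tendsto (fun x => utx u t x) atBot (nhds 0)) :
    ∫ x : ℝ, ut u t x = 0 := by
  obtain ⟨hd0, hc1⟩ :=
    (hu.comp (contDiff_prodMk_right t) : ContDiff ℝ _ fun x => u (t, x)).differentiable_and_deriv
  obtain ⟨hd1, hc2⟩ := hc1.differentiable_and_deriv
  obtain ⟨hd2, -⟩ := hc2.differentiable_and_deriv
  obtain ⟨-, hct⟩ := (hu.ut_slice t).differentiable_and_deriv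
  obtain ⟨hdt, -⟩ := hct.differentiable_and_deriv
  have h0 (x : ℝ) : HasDerivAt (fun y => u (t, y)) (ux u t x) x := (hd0 x).hasDerivAt
  have h1 (x : ℝ) : HasDerivAt (fun y => ux u t y) (uxx u t x) x := (hd1 x).hasDerivAt
  have h2 (x : ℝ) : HasDerivAt (fun y => uxx u t y) (uxxx u t x) x := (hd2 x).hasDerivAt
  have ht (x : ℝ) : HasDerivAt (fun y => utx u t y) (utxx u t x) x := (hdt x).hasDerivAt
  let F : ℝ → ℝ := fun x => utx u t x +
    2 * (u (t, x) * (u (t, x) + ux u t x - uxx u t x) - ux u t x * ux u t x)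
  have hF (x : ℝ) : HasDerivAt F (ut u t x) x := by
    refine ((ht x).add ((((h0 x).mul (((h0 x).add (h1 x)).sub (h2 x))).sub
      ((h1 x).mul (h1 x))).const_mul 2)).congr_deriv ?_
    have h := hsol t x
    simp only [SolvesAt] at h
    simp only [Pi.add_apply, Pi.sub_apply]
    linear_combination -h
  have hlim {l : Filter ℝ} (hl0 : Tendsto (fun x => u (t, x)) l (nhds 0))
      (hl1 : Tendsto (fun x => ux u t x) l (nhds 0))
      (hl2 : Tendsto (fun x => uxx u t x) l (nhds 0))
      (hlt : Tendsto (fun x => utx u t x) l (nhds 0)) : Tendsto F l (nhds 0) := by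
    simpa using hlt.add (((hl0.mul ((hl0.add hl1).sub hl2)).sub (hl1.mul hl1)).const_mul 2)
  simpa using integral_of_hasDerivAt_of_tendsto hF hint
    (hlim hu_bot hux_bot huxx_bot hutx_bot) (hlim hu_top hux_top huxx_top hutx_top)
end

section
/- Let u : ℝ × ℝ → ℝ be a smooth solution of equation (∗) and let t ∈ ℝ be fixed. Assume that the function x ↦ e^{x}(u_t − u_{txx})(t,x) is Lebesgue integrable on ℝ, and that e^{x}(2u_x² − 4u u_x + 2u u_{xx})(t,x) tends to 0 as x → +∞ and as x → −∞. Then ∫_ℝ e^{x}(u_t − u_{txx})(t,x) dx = 0; that is, the conserved quantity H₃(t) = ∫_ℝ e^{x}(u − u_{xx})(t,x) dx has zero time derivative. -/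
open Real MeasureTheory Set Filter

/-- The `x`-derivative of the flux `e^x (2u_x² − 4u u_x + 2u u_xx)` of a solution of (∗) is
minus the density `e^x (u_t − u_txx)`. -/
theorem hasDerivAt_flux {u : ℝ × ℝ → ℝ} (hu : ContDiff ℝ (⊤ : ℕ∞) u) {t x : ℝ}
    (hsol : SolvesAt u t x) :
    HasDerivAt (fun x => Real.exp x * (2 * (ux u t x) ^ 2
      - 4 * u (t, x) * ux u t x + 2 * u (t, x) * uxx u t x))
      (-(Real.exp x * (ut u t x - utxx u t x))) x := by
  have h₀ : ContDiff ℝ (⊤ : ℕ∞) (fun y => u (t, y)) := hu.comp (contDiff_prodMk_right t)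
  have h₁ : ContDiff ℝ (⊤ : ℕ∞) (ux u t) := (contDiff_infty_iff_deriv.1 h₀).2
  have h₂ : ContDiff ℝ (⊤ : ℕ∞) (uxx u t) := (contDiff_infty_iff_deriv.1 h₁).2
  have d₀ : HasDerivAt (fun y => u (t, y)) (ux u t x) x :=
    (h₀.differentiable (by simp) x).hasDerivAt
  have d₁ : HasDerivAt (ux u t) (uxx u t x) x := (h₁.differentiable (by simp) x).hasDerivAt
  have d₂ : HasDerivAt (uxx u t) (uxxx u t x) x := (h₂.differentiable (by simp) x).hasDerivAt
  unfold SolvesAt at hsol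
  rw [hsol]
  refine ((Real.hasDerivAt_exp x).mul ((((d₁.pow 2).const_mul 2).sub
    ((d₀.const_mul 4).mul d₁)).add ((d₀.const_mul 2).mul d₂))).congr_deriv ?_
  simp only [Pi.add_apply, Pi.sub_apply, Pi.mul_apply, Pi.pow_apply]
  ring

/-- Theorem 3.2, quantity `H₃` (with `f ≡ 1`): for a smooth solution of (∗) with
`x ↦ e^x (u_t − u_txx)(t, x)` integrable and `e^x (2u_x² − 4u u_x + 2u u_xx)` decaying at
spatial infinity, `∫ e^x (u_t − u_txx)(t, x) dx = 0`, i.e. the conserved quantity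
`H₃ (t) = ∫ e^x (u − u_xx)(t, x) dx` has zero time derivative. -/
theorem conserved_quantity_H3 (u : ℝ × ℝ → ℝ) (hu : ContDiff ℝ (⊤ : ℕ∞) u)
    (hsol : IsSolution u) (t : ℝ)
    (hint : Integrable (fun x => Real.exp x * (ut u t x - utxx u t x)))
    (hflux_top : Tendsto (fun x => Real.exp x * (2 * (ux u t x) ^ 2
      - 4 * u (t, x) * ux u t x + 2 * u (t, x) * uxx u t x)) atTop (nhds 0))
    (hflux_bot : Tendsto (fun x => Real.exp x * (2 * (ux u t x) ^ 2
      - 4 * u (t, x) * ux u t x + 2 * u (t, x) * uxx u t x)) atBot (nhds 0)) :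
    ∫ x : ℝ, Real.exp x * (ut u t x - utxx u t x) = 0 := by
  have h := integral_of_hasDerivAt_of_tendsto (fun x => hasDerivAt_flux hu (hsol t x))
    hint.neg hflux_bot hflux_top
  rwa [integral_neg, sub_zero, neg_eq_zero] at h
end

section
/- Let a < b be real numbers and define S_{a,b}(y) := G(b − y) − G(a − y), where G(x) = (1 − sgn(x))·e^{−|x|}/2. Then: (i) S_{a,b}(y) = 0 for every y < a; (ii) S_{a,b}(y) = e^{a−y}(e^{b−a} − 1) > 0 for every y > b; and (iii) S_{a,b} is Lebesgue integrable on ℝ. In particular, S_{a,b} is non-negative outside the compact set [a,b]. -/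
open Real MeasureTheory Set Filter

/-- The kernel `G (x) = (1 − sgn x) e^{−|x|} / 2` (with `sgn 0 = 0`). -/
noncomputable def G (x : ℝ) : ℝ := (1 - Real.sign x) * Real.exp (-|x|) / 2

/-- `S_{a,b} (y) = G (b − y) − G (a − y)`. -/
noncomputable def S (a b y : ℝ) : ℝ := G (b - y) - G (a - y)

theorem G_of_neg {x : ℝ} (hx : x < 0) : G x = Real.exp x := by
  rw [G, Real.sign_of_neg hx, abs_of_neg hx]
  ring_nf

theorem G_of_pos {x : ℝ} (hx : 0 < x) : G x = 0 := by
  simp [G, Real.sign_of_pos hx]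

theorem integrable_G : Integrable G := by
  have h : Integrable ((Set.Iio (0 : ℝ)).indicator Real.exp) :=
    ((integrableOn_exp_Iic 0).mono_set Set.Iio_subset_Iic_self).integrable_indicator
      measurableSet_Iio
  refine h.congr ?_
  filter_upwards [volume.ae_ne (0 : ℝ)] with x hx
  rcases lt_or_gt_of_ne hx with hx | hx
  · rw [Set.indicator_of_mem (Set.mem_Iio.2 hx), G_of_neg hx]
  · rw [Set.indicator_of_notMem (Set.notMem_Iio.2 hx.le), G_of_pos hx]

theorem integrable_S (a b : ℝ) : Integrable (S a b) :=
  (integrable_G.comp_sub_left b).sub (integrable_G.comp_sub_left a)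

theorem S_of_lt_left {a b y : ℝ} (hab : a < b) (hy : y < a) : S a b y = 0 := by
  rw [S, G_of_pos (by linarith), G_of_pos (by linarith), sub_zero]

theorem S_of_right_lt {a b y : ℝ} (hab : a < b) (hy : b < y) :
    S a b y = Real.exp (a - y) * (Real.exp (b - a) - 1) := by
  rw [S, G_of_neg (by linarith), G_of_neg (by linarith), mul_sub, ← Real.exp_add]
  ring_nf

theorem S_pos_of_right_lt {a b y : ℝ} (hab : a < b) (hy : b < y) : 0 < S a b y := by
  rw [S_of_right_lt hab hy]
  exact mul_pos (Real.exp_pos _) (sub_pos.2 (Real.one_lt_exp_iff.2 (sub_pos.2 hab)))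

/-- Theorem 4.2: for `a < b`, the function `S_{a,b}` vanishes on `(−∞, a)`, equals
`e^{a−y}(e^{b−a} − 1) > 0` on `(b, ∞)`, is Lebesgue integrable on `ℝ`, and is
non-negative outside the compact set `[a, b]`. -/
theorem S_ab_properties (a b : ℝ) (hab : a < b) :
    (∀ y : ℝ, y < a → S a b y = 0) ∧
      (∀ y : ℝ, b < y →
        S a b y = Real.exp (a - y) * (Real.exp (b - a) - 1) ∧ 0 < S a b y) ∧
      Integrable (S a b) ∧
      (∀ y : ℝ, y ∉ Set.Icc a b → 0 ≤ S a b y) := by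
  refine ⟨fun y hy => S_of_lt_left hab hy,
    fun y hy => ⟨S_of_right_lt hab hy, S_pos_of_right_lt hab hy⟩, integrable_S a b, ?_⟩
  intro y hy
  rcases lt_or_ge y a with h | h
  · exact (S_of_lt_left hab h).ge
  · exact (S_pos_of_right_lt hab (not_le.1 fun h' => hy ⟨h, h'⟩)).le
end

section
/- Let T > 0 and let u : (0,T) × ℝ → ℝ be differentiable in t and x with u(t,·) continuous and u(t,·)² Lebesgue integrable for each t ∈ (0,T), satisfying the nonlocal equation u_t(t,x) + u(t,x)² − 2u(t,x)u_x(t,x) = ∫_ℝ G(x − y) u(t,y)² dy for all (t,x) ∈ (0,T) × ℝ, where G(x) = (1 − sgn(x))·e^{−|x|}/2. Assume that t ↦ ∫_ℝ |u(t,x)| dx is finite and constant on (0,T), and that there exist 0 < T₀ < T₁ < T and b ∈ ℝ such that u(t,x) = 0 for all (t,x) ∈ (T₀,T₁) × (−∞, b). Then u ≡ 0 on (0,T) × ℝ. -/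
open Real MeasureTheory Set Filter

theorem G_nonneg (x : ℝ) : 0 ≤ G x := by
  have hs : Real.sign x ≤ 1 := by
    rcases Real.sign_apply_eq x with h | h | h <;> rw [h] <;> norm_num
  unfold G
  have := sub_nonneg.2 hs
  positivity

theorem G_pos_of_neg {x : ℝ} (hx : x < 0) : 0 < G x := by
  rw [G, Real.sign_of_neg hx]
  have := Real.exp_pos (-|x|)
  linarith

theorem G_le_one (x : ℝ) : G x ≤ 1 := by
  have hs : -1 ≤ Real.sign x := by
    rcases Real.sign_apply_eq x with h | h | h <;> rw [h] <;> norm_num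
  have he : Real.exp (-|x|) ≤ 1 := Real.exp_le_one_iff.2 (by simp)
  unfold G
  nlinarith [Real.exp_pos (-|x|)]

theorem measurable_G : Measurable G := by
  have hs : Measurable Real.sign :=
    Measurable.ite measurableSet_Iio measurable_const
      (Measurable.ite measurableSet_Ioi measurable_const measurable_const)
  unfold G
  fun_prop

theorem integrable_G_sub_mul {f : ℝ → ℝ} (hf : Integrable f) (x : ℝ) :
    Integrable (fun y => G (x - y) * f y) := by
  refine hf.bdd_mul (c := 1) ?_ (Eventually.of_forall fun y => ?_)
  · exact (measurable_G.comp (measurable_const.sub measurable_id)).aestronglyMeasurable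
  · rw [Real.norm_of_nonneg (G_nonneg _)]
    exact G_le_one _

/-- If `f` vanishes on a left half-line and `G ∗ f²` vanishes at a point of it, then `f = 0`. -/
theorem eq_zero_of_integral_G_eq_zero {f : ℝ → ℝ} (hf : Continuous f)
    (hsq : Integrable (fun y => f y ^ 2)) {x : ℝ} (hleft : ∀ y ≤ x, f y = 0)
    (hint : ∫ y, G (x - y) * f y ^ 2 = 0) : f = 0 := by
  have hae := (integral_eq_zero_iff_of_nonneg
    (fun y => mul_nonneg (G_nonneg (x - y)) (sq_nonneg (f y)))
    (integrable_G_sub_mul hsq x)).1 hint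
  refine (Continuous.ae_eq_iff_eq volume hf continuous_zero).1 ?_
  filter_upwards [hae] with y hy
  rcases le_or_gt y x with hyx | hyx
  · exact hleft y hyx
  · simpa [(G_pos_of_neg (sub_neg.2 hyx)).ne'] using hy

/-- Corollary 4.1 (unique continuation): a solution of the nonlocal form of (∗) on
`(0, T) × ℝ` with invariant (finite) `L¹` norm which vanishes on a horizontal strip
`(T₀, T₁) × (−∞, b)` vanishes identically on `(0, T) × ℝ`. -/
theorem unique_continuation (T : ℝ) (hT : 0 < T) (u : ℝ × ℝ → ℝ)
    (hdiff : ∀ t ∈ Set.Ioo 0 T, ∀ x : ℝ,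
      DifferentiableAt ℝ (fun s => u (s, x)) t ∧ DifferentiableAt ℝ (fun y => u (t, y)) x)
    (hcont : ∀ t ∈ Set.Ioo 0 T, Continuous (fun x => u (t, x)))
    (hsq : ∀ t ∈ Set.Ioo 0 T, Integrable (fun x => (u (t, x)) ^ 2))
    (heq : ∀ t ∈ Set.Ioo 0 T, ∀ x : ℝ,
      ut u t x + (u (t, x)) ^ 2 - 2 * u (t, x) * ux u t x
        = ∫ y : ℝ, G (x - y) * (u (t, y)) ^ 2)
    (hL1 : ∀ t ∈ Set.Ioo 0 T, Integrable (fun x => u (t, x)))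
    (hconst : ∃ c : ℝ, ∀ t ∈ Set.Ioo 0 T, (∫ x : ℝ, |u (t, x)|) = c)
    (hvanish : ∃ T₀ T₁ b : ℝ, 0 < T₀ ∧ T₀ < T₁ ∧ T₁ < T ∧
      ∀ t ∈ Set.Ioo T₀ T₁, ∀ x : ℝ, x < b → u (t, x) = 0) :
    ∀ t ∈ Set.Ioo 0 T, ∀ x : ℝ, u (t, x) = 0 := by
  obtain ⟨c, hc⟩ := hconst
  obtain ⟨T₀, T₁, b, h₀, h₀₁, h₁, hv⟩ := hvanish
  obtain ⟨τ, hτ⟩ := nonempty_Ioo.2 h₀₁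
  have hτT : τ ∈ Set.Ioo 0 T := ⟨h₀.trans hτ.1, hτ.2.trans h₁⟩
  have hb : b - 1 < b := by linarith
  have hut : ut u τ (b - 1) = 0 := by
    have hev : (fun s => u (s, b - 1)) =ᶠ[nhds τ] fun _ => 0 := by
      filter_upwards [Ioo_mem_nhds hτ.1 hτ.2] with s hs using hv s hs _ hb
    rw [ut, hev.deriv_eq, deriv_const]
  have hint : ∫ y : ℝ, G (b - 1 - y) * u (τ, y) ^ 2 = 0 := by
    rw [← heq τ hτT, hut, hv τ hτ _ hb]
    ring
  have hzero : (fun x => u (τ, x)) = 0 :=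
    eq_zero_of_integral_G_eq_zero (hcont τ hτT) (hsq τ hτT)
      (fun y hy => hv τ hτ y (hy.trans_lt hb)) hint
  have hc0 : c = 0 := by
    rw [← hc τ hτT]
    simp [fun x => congrFun hzero x]
  intro t ht x
  have hae := (integral_eq_zero_iff_of_nonneg (fun x => abs_nonneg (u (t, x)))
    (hL1 t ht).abs).1 ((hc t ht).trans hc0)
  have h := (Continuous.ae_eq_iff_eq volume (hcont t ht).abs continuous_zero).1 hae
  exact abs_eq_zero.1 (congrFun h x)
end
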